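/- Let (𝒫,𝒬) be a weak parallelepiped structure on a nonempty set X. For every finitely supported function f: X → ℂ, ∑_{x∈𝒬} ∏_{ε∈{0,1}³} C^{|ε|}f(x_ε) ≥ 0, where C denotes complex conjugation and |ε| = ε₁+ε₂+ε₃. Consequently ‖f‖_𝒬 := (this sum)^{1/8} is well defined, the map f ↦ ‖f‖_𝒬 is a seminorm on the space of finitely supported complex-valued functions on X, and it is a norm if and only if the structure (𝒫,𝒬) is strong. -/

import Mathlib

open scoped Pointwise

namespace HK

/-- Quadruples of elements of `X`, indexed by the vertices `00, 01, 10, 11` of the square. -/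
abbrev Quad (X : Type) := X × X × X × X

/-- Vertices of the cube `{0,1}³`. -/
abbrev Vtx := Fin 3 → Bool

/-- Elements of `X^{[3]} = X⁸`, indexed by the vertices of the cube. -/
abbrev Cube (X : Type) := Vtx → X

variable {X Y : Type}

/-- Apply a map coordinatewise to a quadruple. -/
def map4 (f : X → Y) (p : Quad X) : Quad Y := (f p.1, f p.2.1, f p.2.2.1, f p.2.2.2)

/-- Apply a map coordinatewise to a cube. -/
def mapCube (f : X → Y) (x : Cube X) : Cube Y := fun v => f (x v)

/-- A weak parallelogram structure: the relation `(x00,x01) ∼ (x10,x11) ↔ (x00,x01,x10,x11) ∈ P`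
is an equivalence relation, `P` is invariant under exchanging the two middle entries, and
any three points can be completed to a parallelogram. -/
def IsWeakParallelogram (P : Set (Quad X)) : Prop :=
  (∀ a b : X, (a, b, a, b) ∈ P) ∧
  (∀ a b c d : X, (a, b, c, d) ∈ P → (c, d, a, b) ∈ P) ∧
  (∀ a b c d e f : X, (a, b, c, d) ∈ P → (c, d, e, f) ∈ P → (a, b, e, f) ∈ P) ∧
  (∀ a b c d : X, (a, b, c, d) ∈ P → (a, c, b, d) ∈ P) ∧
  (∀ a b c : X, ∃ d, (a, b, c, d) ∈ P)

/-- A strong parallelogram structure: the completing fourth point is unique. -/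
def IsStrongParallelogram (P : Set (Quad X)) : Prop :=
  IsWeakParallelogram P ∧ ∀ a b c : X, ∃! d, (a, b, c, d) ∈ P

/-- The entry of a quadruple at a vertex of the square. -/
def quadAt (p : Quad X) : Bool → Bool → X
  | false, false => p.1
  | false, true => p.2.1
  | true, false => p.2.2.1
  | true, true => p.2.2.2

/-- The cube whose face `ε₁ = 0` is `p` and whose face `ε₁ = 1` is `q`. -/
def joinQuad (p q : Quad X) : Cube X :=
  fun v => if v 0 = false then quadAt p (v 1) (v 2) else quadAt q (v 1) (v 2)

/-- The vertex of the cube with value `b` at coordinate `i` and values `u,v` at the two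
remaining coordinates, taken in increasing order. -/
def insert3 (i : Fin 3) (b u v : Bool) : Vtx :=
  if i = 0 then ![b, u, v] else if i = 1 then ![u, b, v] else ![u, v, b]

/-- The face `{v : v i = b}` of a cube, as a quadruple in lexicographic order. -/
def face (x : Cube X) (i : Fin 3) (b : Bool) : Quad X :=
  (x (insert3 i b false false), x (insert3 i b false true),
   x (insert3 i b true false), x (insert3 i b true true))

/-- The permutations of the vertices of the cube induced by Euclidean isometries of the unit
cube: a permutation of the three coordinates composed with flips of some coordinates. -/
def cubeSym (σ : Equiv.Perm (Fin 3)) (c : Vtx) (v : Vtx) : Vtx :=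
  fun j => xor (v (σ j)) (c j)

/-- A weak parallelepiped structure `(P, Q)`: every face of an element of `Q` lies in `P`;
`Q` is invariant under the Euclidean permutations of the cube; the relation `≈` on `P`
(`p ≈ q ↔ joinQuad p q ∈ Q`) is an equivalence relation; and seven points whose three
determined faces lie in `P` can be completed to an element of `Q`. -/
def IsWeakParallelepiped (P : Set (Quad X)) (Q : Set (Cube X)) : Prop :=
  IsWeakParallelogram P ∧
  (∀ x ∈ Q, ∀ (i : Fin 3) (b : Bool), face x i b ∈ P) ∧
  (∀ (σ : Equiv.Perm (Fin 3)) (c : Vtx), ∀ x ∈ Q, (fun v => x (cubeSym σ c v)) ∈ Q) ∧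
  (∀ p ∈ P, joinQuad p p ∈ Q) ∧
  (∀ p q : Quad X, joinQuad p q ∈ Q → joinQuad q p ∈ Q) ∧
  (∀ p q r : Quad X, joinQuad p q ∈ Q → joinQuad q r ∈ Q → joinQuad p r ∈ Q) ∧
  (∀ x000 x001 x010 x011 x100 x101 x110 : X,
    (x000, x001, x010, x011) ∈ P → (x000, x010, x100, x110) ∈ P →
    (x000, x001, x100, x101) ∈ P →
    ∃ x111, joinQuad (x000, x001, x010, x011) (x100, x101, x110, x111) ∈ Q)

/-- A strong parallelepiped structure: the completing eighth point is unique. -/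
def IsStrongParallelepiped (P : Set (Quad X)) (Q : Set (Cube X)) : Prop :=
  IsWeakParallelepiped P Q ∧
  ∀ x000 x001 x010 x011 x100 x101 x110 : X,
    (x000, x001, x010, x011) ∈ P → (x000, x010, x100, x110) ∈ P →
    (x000, x001, x100, x101) ∈ P →
    ∃! x111, joinQuad (x000, x001, x010, x011) (x100, x101, x110, x111) ∈ Q

/-- The setoid on `X²` given by the parallelogram relation `∼`. -/
def baseSetoid (P : Set (Quad X)) (hP : IsWeakParallelogram P) : Setoid (X × X) where
  r p q := (p.1, p.2, q.1, q.2) ∈ P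
  iseqv := ⟨fun p => hP.1 p.1 p.2,
            fun h => hP.2.1 _ _ _ _ h,
            fun h h' => hP.2.2.1 _ _ _ _ _ _ h h'⟩

/-- The base `B = X²/∼` of a weak parallelogram structure. -/
def Base (P : Set (Quad X)) (hP : IsWeakParallelogram P) : Type := Quotient (baseSetoid P hP)

/-- The class `⟨x,y⟩ ∈ B` of a pair `(x,y)`. -/
def cls (P : Set (Quad X)) (hP : IsWeakParallelogram P) (x y : X) : Base P hP :=
  Quotient.mk (baseSetoid P hP) (x, y)

/-- The Gowers-type sum over parallelograms attached to a finitely supported `f : X → ℂ`. -/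
noncomputable def gSum2 (P : Set (Quad X)) (f : X →₀ ℂ) : ℂ :=
  ∑ᶠ q ∈ P, f q.1 * (starRingEnd ℂ) (f q.2.1) * (starRingEnd ℂ) (f q.2.2.1) * f q.2.2.2

/-- The seminorm `‖f‖_P = (gSum2 P f)^{1/4}`. -/
noncomputable def pNorm (P : Set (Quad X)) (f : X →₀ ℂ) : ℝ :=
  (gSum2 P f).re ^ ((1 : ℝ) / 4)

/-- `C^{|ε|} z`: conjugate `z` when the vertex `v` has an odd number of `1` entries. -/
noncomputable def cConjFactor (v : Vtx) (z : ℂ) : ℂ :=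
  if xor (v 0) (xor (v 1) (v 2)) then (starRingEnd ℂ) z else z

/-- The Gowers-type sum over parallelepipeds attached to a finitely supported `f : X → ℂ`. -/
noncomputable def gSum3 (Q : Set (Cube X)) (f : X →₀ ℂ) : ℂ :=
  ∑ᶠ x ∈ Q, ∏ v : Vtx, cConjFactor v (f (x v))

/-- The seminorm `‖f‖_Q = (gSum3 Q f)^{1/8}`. -/
noncomputable def qNorm (Q : Set (Cube X)) (f : X →₀ ℂ) : ℝ :=
  (gSum3 Q f).re ^ ((1 : ℝ) / 8)

/-- The structure group of a parallelepiped structure, as a set of bijections of `X`: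
those `g` mapping every parallelogram to an equivalent parallelogram. -/
def structSet (P : Set (Quad X)) (Q : Set (Cube X)) : Set (Equiv.Perm X) :=
  {g | ∀ p ∈ P, map4 g p ∈ P ∧ joinQuad (map4 g p) p ∈ Q}

/-- `x` and `y` lie in the same fiber of `π : X → B`, `π(x) = ⟨i,x⟩`. -/
def sameFiber (P : Set (Quad X)) (i x y : X) : Prop := (i, x, i, y) ∈ P

/-- A vertical quadruple: all four points lie in one fiber. -/
def VerticalQ (P : Set (Quad X)) (i : X) (w : Quad X) : Prop :=
  sameFiber P i w.1 w.2.1 ∧ sameFiber P i w.2.1 w.2.2.1 ∧ sameFiber P i w.2.2.1 w.2.2.2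

/-- `y = u·x` where `u = [w]` is the class of the vertical parallelogram `w`:
`(x,x,x,y)` is a parallelogram equivalent to `w`. -/
def actsRel (P : Set (Quad X)) (Q : Set (Cube X)) (w : Quad X) (x y : X) : Prop :=
  (x, x, x, y) ∈ P ∧ joinQuad (x, x, x, y) w ∈ Q

section Groups

variable (G : Type) [Group G]

/-- The diagonal embedding `G → G^{[2]}`. -/
def diagHom2 : G →* Quad G where
  toFun g := (g, g, g, g)
  map_one' := rfl
  map_mul' _ _ := rfl

/-- The diagonal embedding `G → G^{[3]}`. -/
def diagHom3 : G →* Cube G where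
  toFun g := fun _ => g
  map_one' := rfl
  map_mul' _ _ := rfl

/-- The two dimensional edge group `G^{[2,1]}`. -/
def edgeGroup2 : Subgroup (Quad G) :=
  Subgroup.closure
    {q : Quad G | ∃ g : G, q = (g, g, 1, 1) ∨ q = (g, 1, g, 1) ∨ q = (g, g, g, g)}

/-- The second commutator subgroup `G₃ = [G, G₂]`. -/
def secondCommutator : Subgroup G := ⁅(⊤ : Subgroup G), commutator G⁆

variable {G}

/-- The edge group `F^{[2,1]}` of a subgroup `F ≤ G`, inside `G^{[2]}`. -/
def edgeGroup2Of (F : Subgroup G) : Subgroup (Quad G) :=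
  Subgroup.closure
    {q : Quad G | ∃ u ∈ F, q = (u, u, 1, 1) ∨ q = (u, 1, u, 1) ∨ q = (u, u, u, u)}

/-- `F^{[2]} = F⁴` as a subgroup of `G^{[2]}`. -/
def quadSub (F : Subgroup G) : Subgroup (Quad G) := F.prod (F.prod (F.prod F))

/-- Faces of the cube `{0,1}³`. -/
def IsFace3 (α : Set Vtx) : Prop := ∃ (i : Fin 3) (b : Bool), α = {v : Vtx | v i = b}

/-- Edges of the cube `{0,1}³`. -/
def IsEdge3 (α : Set Vtx) : Prop :=
  ∃ (i j : Fin 3) (b c : Bool), i ≠ j ∧ α = {v : Vtx | v i = b ∧ v j = c}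

open Classical in
/-- The element `g^{[3,α]}` of `G^{[3]}`, with coordinate `g` on `α` and `1` elsewhere. -/
noncomputable def cubeElt (α : Set Vtx) (g : G) : Cube G :=
  fun v => if v ∈ α then g else 1

variable (G)

/-- The face group `G^{[3,2]}`, generated by the `g^{[3,f]}` for faces `f` of the cube. -/
noncomputable def faceGroup : Subgroup (Cube G) :=
  Subgroup.closure {x : Cube G | ∃ (g : G) (α : Set Vtx), IsFace3 α ∧ x = cubeElt α g}

variable {G}

/-- The edge group `F^{[3,1]}` of a subgroup `F ≤ G`, generated by the `u^{[3,e]}` for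
`u ∈ F` and edges `e` of the cube. -/
noncomputable def edgeGroup3 (F : Subgroup G) : Subgroup (Cube G) :=
  Subgroup.closure {x : Cube G | ∃ u ∈ F, ∃ α : Set Vtx, IsEdge3 α ∧ x = cubeElt α u}

end Groups

/-- The data realizing `(PY, QY)` as the nilparallelepiped structure associated to
`G`, `F`, `Γ` via the coset projection `p : G → Y ≅ G/Γ`. -/
def NilWitness (G : Type) [Group G] (F Γ : Subgroup G) {Y : Type} (p : G → Y)
    (PY : Set (Quad Y)) (QY : Set (Cube Y)) : Prop :=
  commutator G ≤ F ∧ F ≤ Subgroup.center G ∧ Γ ⊓ F = ⊥ ∧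
  Function.Surjective p ∧ (∀ g g' : G, p g = p g' ↔ g⁻¹ * g' ∈ Γ) ∧
  PY = map4 p '' ((edgeGroup2 G : Set (Quad G)) * (quadSub F : Set (Quad G))) ∧
  QY = mapCube p '' ((faceGroup G : Set (Cube G)) * (edgeGroup3 F : Set (Cube G)))

/-- `(PY, QY)` is a nilparallelepiped structure. -/
def IsNilStructure {Y : Type} (PY : Set (Quad Y)) (QY : Set (Cube Y)) : Prop :=
  ∃ (G : Type) (inst : Group G) (F Γ : @Subgroup G inst) (p : G → Y),
    @NilWitness G inst F Γ Y p PY QY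

/-- A splitting of the exact sequence `0 → F → P_s → B → 0` for `s = ⟨a₀, b₀⟩`, encoded
by a lift `ψ : X → 𝒫_s` of a homomorphism section `φ : B → P_s` of `q_s`:
`ψ x` is a parallelogram in `𝒫_s` representing the class `φ(π(x))`. -/
def IsSplittingAt (P : Set (Quad X)) (Q : Set (Cube X)) (i a₀ b₀ : X) : Prop :=
  ∃ ψ : X → Quad X,
    (∀ x, ψ x ∈ P) ∧
    (∀ x, (a₀, b₀, (ψ x).1, (ψ x).2.1) ∈ P) ∧
    (∀ x, ((ψ x).1, (ψ x).2.2.1, i, x) ∈ P) ∧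
    (∀ x y, (i, x, i, y) ∈ P → joinQuad (ψ x) (ψ y) ∈ Q) ∧
    (∀ x1 x2 x3, (x1, x3, i, x2) ∈ P →
      ∃ c d, joinQuad ((ψ x1).2.2.1, (ψ x1).2.2.2, c, d) (ψ x2) ∈ Q ∧
        joinQuad ((ψ x1).1, (ψ x1).2.1, c, d) (ψ x3) ∈ Q)

/-- `(B, c)` is a realization of the base group of the parallelogram structure `P`,
`c x y` realizing the class `⟨x,y⟩`. -/
def IsBaseRealization (P : Set (Quad X)) (B : Type) [AddCommGroup B] (c : X → X → B) : Prop :=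
  (Function.Surjective fun p : X × X => c p.1 p.2) ∧
  (∀ a b a' b' : X, c a b = c a' b' ↔ (a, b, a', b') ∈ P) ∧
  (∀ a b d : X, c a b + c b d = c a d)

/-- `(F, fl)` is a realization of the fiber group of the parallelepiped structure `(P, Q)`:
`fl` maps vertical parallelograms onto `F`, separates exactly the `≈`-classes, and is
additive with respect to the composition of vertical parallelograms. -/
def IsFiberRealization (P : Set (Quad X)) (Q : Set (Cube X)) (i : X) (F : Type)
    [AddCommGroup F] (fl : Quad X → F) : Prop :=
  (∀ u : F, ∃ w, VerticalQ P i w ∧ fl w = u) ∧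
  (∀ w w' : Quad X, VerticalQ P i w → VerticalQ P i w' →
    (fl w = fl w' ↔ joinQuad w w' ∈ Q)) ∧
  (∀ x0 x1 x2 x3 x4 x5 : X, sameFiber P i x0 x1 → sameFiber P i x1 x2 →
    sameFiber P i x2 x3 → sameFiber P i x3 x4 → sameFiber P i x4 x5 →
    fl (x0, x1, x2, x3) + fl (x2, x3, x4, x5) = fl (x0, x1, x4, x5))

/-- A divisible (equivalently, injective) abelian group. -/
def IsDivisibleGroup (F : Type) [AddCommGroup F] : Prop :=
  ∀ (u : F) (n : ℕ), 0 < n → ∃ v : F, n • v = u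

/-- A projective abelian group (projective as a `ℤ`-module). -/
def IsProjectiveAdd (B : Type) [AddCommGroup B] : Prop := Module.Projective ℤ B

section RelationSums

open scoped ComplexOrder ComplexConjugate

variable {α : Type*} {R : α → α → Prop}

open Classical in
/-- The sum of `A p` over the elements `p` of `t` whose class under the partial equivalence
relation `R` is `k`. -/
noncomputable def classSum (R : α → α → Prop) (t : Finset α) (A : α → ℂ) (k : Set α) : ℂ :=
  ∑ p ∈ t, if R p p ∧ {q | R p q} = k then A p else 0

open Classical in
/-- The sesquilinear form attached to a relation on a finite set. -/
noncomputable def relForm (R : α → α → Prop) (t : Finset α) (A B : α → ℂ) : ℂ :=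
  ∑ p ∈ t, ∑ q ∈ t, if R p q then A p * conj (B q) else 0

open Classical in
theorem relForm_eq_sum_classSum (hs : ∀ p q, R p q → R q p)
    (ht : ∀ p q r, R p q → R q r → R p r) (t : Finset α) (A B : α → ℂ) :
    relForm R t A B =
      ∑ k ∈ t.image (fun p => {q | R p q}), classSum R t A k * conj (classSum R t B k) := by
  have key : ∀ p q, R p q ↔ R p p ∧ R q q ∧ {r | R p r} = {r | R q r} := by
    intro p q
    constructor
    · intro h
      refine ⟨ht _ _ _ h (hs _ _ h), ht _ _ _ (hs _ _ h) h, ?_⟩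
      ext r
      exact ⟨fun h' => ht _ _ _ (hs _ _ h) h', fun h' => ht _ _ _ h h'⟩
    · rintro ⟨-, hq, he⟩
      have : q ∈ {r | R q r} := hq
      rwa [← he] at this
  simp only [classSum, map_sum, Finset.sum_mul_sum]
  rw [Finset.sum_comm, relForm]
  refine Finset.sum_congr rfl fun p hp => ?_
  rw [Finset.sum_comm]
  refine Finset.sum_congr rfl fun q hq => ?_
  rw [Finset.sum_eq_single {r | R p r}]
  · by_cases h : R p q
    · have := (key p q).1 h
      simp [h, this.1, this.2.1, this.2.2]
    · rw [if_neg h]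
      by_cases h1 : R p p
      · rw [if_neg (c := R q q ∧ _)]
        · simp
        · rintro ⟨h2, h3⟩
          exact h ((key p q).2 ⟨h1, h2, h3.symm⟩)
      · simp [h1]
  · intro k _ hk
    rw [if_neg fun h => hk h.2.symm, zero_mul]
  · intro h
    exact absurd (Finset.mem_image_of_mem _ hp) h

theorem relForm_self_eq (hs : ∀ p q, R p q → R q p)
    (ht : ∀ p q r, R p q → R q r → R p r) (t : Finset α) (A : α → ℂ) :
    ∃ K : Finset (Set α), ∀ B : α → ℂ,
      relForm R t A B = ∑ k ∈ K, classSum R t A k * conj (classSum R t B k) ∧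
      relForm R t B B = ((∑ k ∈ K, ‖classSum R t B k‖ ^ 2 : ℝ) : ℂ) := by
  classical
  refine ⟨t.image (fun p => {q | R p q}), fun B => ⟨relForm_eq_sum_classSum hs ht t A B, ?_⟩⟩
  rw [relForm_eq_sum_classSum hs ht]
  push_cast
  exact Finset.sum_congr rfl fun k _ => Complex.mul_conj' _

theorem relForm_self_nonneg (hs : ∀ p q, R p q → R q p)
    (ht : ∀ p q r, R p q → R q r → R p r) (t : Finset α) (A : α → ℂ) :
    0 ≤ relForm R t A A := by
  obtain ⟨K, hK⟩ := relForm_self_eq hs ht t A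
  rw [(hK A).2]
  exact Complex.zero_le_real.2 (Finset.sum_nonneg fun k _ => sq_nonneg _)

/-- Cauchy–Schwarz for the form attached to a partial equivalence relation. -/
theorem norm_relForm_sq_le (hs : ∀ p q, R p q → R q p)
    (ht : ∀ p q r, R p q → R q r → R p r) (t : Finset α) (A B : α → ℂ) :
    ‖relForm R t A B‖ ^ 2 ≤ ‖relForm R t A A‖ * ‖relForm R t B B‖ := by
  obtain ⟨K, hK⟩ := relForm_self_eq hs ht t A
  rw [(hK B).1, (hK A).2, (hK B).2, Complex.norm_of_nonneg (by positivity),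
    Complex.norm_of_nonneg (by positivity)]
  refine le_trans ?_ (Finset.sum_mul_sq_le_sq_mul_sq K _ _)
  gcongr
  refine (norm_sum_le _ _).trans (le_of_eq ?_)
  simp

end RelationSums

section GowersForm

open scoped ComplexOrder ComplexConjugate

variable {P : Set (Quad X)} {Q : Set (Cube X)}

theorem prod_vtx {M : Type*} [CommMonoid M] (g : Vtx → M) :
    ∏ v : Vtx, g v =
      g ![false, false, false] * g ![false, false, true] * g ![false, true, false] *
        g ![false, true, true] * (g ![true, false, false] * g ![true, false, true] *
        g ![true, true, false] * g ![true, true, true]) := by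
  have : (Finset.univ : Finset Vtx) = {![false, false, false], ![false, false, true],
      ![false, true, false], ![false, true, true], ![true, false, false], ![true, false, true],
      ![true, true, false], ![true, true, true]} := by decide
  rw [this]
  repeat rw [Finset.prod_insert (by decide)]
  rw [Finset.prod_singleton]
  simp only [mul_assoc]

theorem forall_vtx {p : Vtx → Prop} :
    (∀ v, p v) ↔ p ![false, false, false] ∧ p ![false, false, true] ∧
      p ![false, true, false] ∧ p ![false, true, true] ∧ p ![true, false, false] ∧
      p ![true, false, true] ∧ p ![true, true, false] ∧ p ![true, true, true] := by
  refine ⟨fun h => ⟨h _, h _, h _, h _, h _, h _, h _, h _⟩, ?_⟩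
  rintro ⟨h1, h2, h3, h4, h5, h6, h7, h8⟩ v
  have : v = ![v 0, v 1, v 2] := by ext i; fin_cases i <;> rfl
  rw [this]
  cases v 0 <;> cases v 1 <;> cases v 2 <;> assumption

theorem joinQuad_face (x : Cube X) : joinQuad (face x 0 false) (face x 0 true) = x := by
  funext v
  revert v
  rw [forall_vtx]
  simp [joinQuad, quadAt, face, insert3]

/-- A cube is the same as a pair of opposite faces. -/
def splitCube : Cube X ≃ Quad X × Quad X where
  toFun x := (face x 0 false, face x 0 true)
  invFun p := joinQuad p.1 p.2
  left_inv := joinQuad_face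
  right_inv p := by simp [joinQuad, quadAt, face, insert3]

open Classical in
/-- The Gowers form: one function for each vertex of the cube, the sum being restricted to
cubes with vertices in `s`. -/
noncomputable def gowersForm (Q : Set (Cube X)) (s : Finset X) (F : Vtx → X → ℂ) : ℂ :=
  ∑ x ∈ Fintype.piFinset fun _ : Vtx => s,
    if x ∈ Q then ∏ v, cConjFactor v (F v (x v)) else 0

@[simp] theorem cConjFactor_eq_zero {v : Vtx} {a : ℂ} : cConjFactor v a = 0 ↔ a = 0 := by
  unfold cConjFactor; split_ifs <;> simp

theorem gSum3_eq_gowersForm (Q : Set (Cube X)) {s : Finset X} {f : X →₀ ℂ}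
    (hf : f.support ⊆ s) : gSum3 Q f = gowersForm Q s fun _ => f := by
  classical
  rw [gSum3, finsum_mem_def, gowersForm, finsum_eq_sum_of_support_subset]
  · exact Finset.sum_congr rfl fun x _ => by rw [Set.indicator_apply]
  · intro x hx
    rw [Finset.mem_coe, Fintype.mem_piFinset]
    intro v
    refine hf (Finsupp.mem_support_iff.2 fun h0 => hx ?_)
    rw [Set.indicator_apply, Finset.prod_eq_zero (Finset.mem_univ v) (by simp [h0]), ite_self]

/-- The product attached to one face of the cube. -/
noncomputable def faceProd (G : Bool → Bool → X → ℂ) (p : Quad X) : ℂ :=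
  G false false p.1 * conj (G false true p.2.1) * conj (G true false p.2.2.1) *
    G true true p.2.2.2

theorem gowersForm_eq_relForm (Q : Set (Cube X)) (s : Finset X) (F : Vtx → X → ℂ) :
    gowersForm Q s F = relForm (fun p q => joinQuad p q ∈ Q) (s ×ˢ s ×ˢ s ×ˢ s)
      (faceProd fun u v => F ![false, u, v]) (faceProd fun u v => F ![true, u, v]) := by
  classical
  rw [relForm, ← Finset.sum_product', gowersForm]
  refine Finset.sum_equiv splitCube (fun x => ?_) fun x _ => ?_
  · simp only [Fintype.mem_piFinset, forall_vtx, splitCube, Equiv.coe_fn_mk, Finset.mem_product,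
      face, insert3]
    simp [and_assoc]
  · simp only [splitCube, Equiv.coe_fn_mk, joinQuad_face]
    refine if_congr Iff.rfl ?_ rfl
    rw [prod_vtx]
    simp [cConjFactor, faceProd, face, insert3]

theorem gowersForm_update_zero (Q : Set (Cube X)) (s : Finset X) (F : Vtx → X → ℂ) (b : Bool) :
    gowersForm Q s (fun v => F (Function.update v 0 b)) =
      relForm (fun p q => joinQuad p q ∈ Q) (s ×ˢ s ×ˢ s ×ˢ s)
        (faceProd fun u v => F ![b, u, v]) (faceProd fun u v => F ![b, u, v]) := by
  have hu : ∀ a u v : Bool, Function.update ![a, u, v] 0 b = ![b, u, v] := by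
    intro a u v; ext i; fin_cases i <;> rfl
  rw [gowersForm_eq_relForm]
  simp only [hu]

theorem gowersForm_comp_perm (h : IsWeakParallelepiped P Q) (s : Finset X) (F : Vtx → X → ℂ)
    (σ : Equiv.Perm (Fin 3)) : gowersForm Q s (fun v => F (v ∘ σ)) = gowersForm Q s F := by
  classical
  have hσ : ∀ (σ : Equiv.Perm (Fin 3)) (x : Cube X), x ∈ Q → (fun v : Vtx => x (v ∘ σ)) ∈ Q := by
    intro σ x hx
    convert h.2.2.1 σ (fun _ => false) x hx using 3
    funext j
    simp [cubeSym]
  have hpar : ∀ (σ : Equiv.Perm (Fin 3)) (v : Vtx),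
      xor ((v ∘ σ) 0) (xor ((v ∘ σ) 1) ((v ∘ σ) 2)) = xor (v 0) (xor (v 1) (v 2)) := by decide
  let τ : Vtx ≃ Vtx := σ.symm.arrowCongr (Equiv.refl Bool)
  have hτ : ∀ v, τ v = v ∘ σ := fun v => rfl
  refine Finset.sum_equiv (τ.arrowCongr (Equiv.refl X)) (fun x => ?_) fun x _ => ?_
  · simp only [Fintype.mem_piFinset, Equiv.arrowCongr_apply, Equiv.coe_refl, Function.comp_apply,
      id_eq]
    exact (τ.symm.forall_congr_right (q := fun v => x v ∈ s)).symm
  · refine if_congr ?_ ?_ rfl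
    · constructor
      · intro hx
        exact hσ σ.symm x hx
      · intro hx
        have := hσ σ _ hx
        convert this using 1
        funext v
        simp [← hτ]
    · refine Fintype.prod_equiv τ _ _ fun v => ?_
      simp only [Equiv.arrowCongr_apply, Equiv.coe_refl, Function.comp_apply, id_eq,
        Equiv.symm_apply_apply]
      simp only [hτ, cConjFactor, hpar]

theorem joinQuad_symm (h : IsWeakParallelepiped P Q) (p q : Quad X) :
    joinQuad p q ∈ Q → joinQuad q p ∈ Q := h.2.2.2.2.1 p q

theorem joinQuad_trans (h : IsWeakParallelepiped P Q) (p q r : Quad X) :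
    joinQuad p q ∈ Q → joinQuad q r ∈ Q → joinQuad p r ∈ Q := h.2.2.2.2.2.1 p q r

theorem gowersForm_const_nonneg (h : IsWeakParallelepiped P Q) (s : Finset X) (f : X → ℂ) :
    0 ≤ gowersForm Q s fun _ => f := by
  rw [gowersForm_eq_relForm]
  exact relForm_self_nonneg (joinQuad_symm h) (joinQuad_trans h) _ _

theorem norm_gowersForm_sq_le (h : IsWeakParallelepiped P Q) (s : Finset X) (F : Vtx → X → ℂ)
    (i : Fin 3) :
    ‖gowersForm Q s F‖ ^ 2 ≤ ∏ b : Bool, ‖gowersForm Q s fun v => F (Function.update v i b)‖ := by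
  have h0 : ∀ F : Vtx → X → ℂ, ‖gowersForm Q s F‖ ^ 2 ≤
      ∏ b : Bool, ‖gowersForm Q s fun v => F (Function.update v 0 b)‖ := by
    intro F
    rw [Fintype.prod_bool, gowersForm_update_zero, gowersForm_update_zero, gowersForm_eq_relForm,
      mul_comm]
    exact norm_relForm_sq_le (joinQuad_symm h) (joinQuad_trans h) _ _ _
  have hu : ∀ b (v : Vtx), Function.update v 0 b ∘ Equiv.swap 0 i =
      Function.update (v ∘ Equiv.swap 0 i) i b := by
    intro b v
    rw [Function.update_comp_equiv]
    simp
  have := h0 fun v => F (v ∘ Equiv.swap 0 i)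
  simp only [hu] at this
  rw [gowersForm_comp_perm h s F] at this
  simpa only [fun b => gowersForm_comp_perm h s (fun v => F (Function.update v i b))
    (Equiv.swap 0 i)] using this

/-- The Cauchy–Schwarz–Gowers inequality. -/
theorem norm_gowersForm_pow_le (h : IsWeakParallelepiped P Q) (s : Finset X)
    (F : Vtx → X → ℂ) :
    ‖gowersForm Q s F‖ ^ 8 ≤ ∏ v, ‖gowersForm Q s fun _ => F v‖ := by
  calc ‖gowersForm Q s F‖ ^ 8 = ((‖gowersForm Q s F‖ ^ 2) ^ 2) ^ 2 := by ring
    _ ≤ ((∏ b : Bool, ‖gowersForm Q s fun v => F (Function.update v 0 b)‖) ^ 2) ^ 2 := by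
        gcongr
        exact norm_gowersForm_sq_le h s F 0
    _ = (∏ b : Bool, ‖gowersForm Q s fun v => F (Function.update v 0 b)‖ ^ 2) ^ 2 := by
        rw [Finset.prod_pow]
    _ ≤ (∏ b : Bool, ∏ c : Bool, ‖gowersForm Q s fun v =>
          F (Function.update (Function.update v 1 c) 0 b)‖) ^ 2 := by
        gcongr with b
        exact norm_gowersForm_sq_le h s (fun v => F (Function.update v 0 b)) 1
    _ = ∏ b : Bool, ∏ c : Bool, ‖gowersForm Q s fun v =>
          F (Function.update (Function.update v 1 c) 0 b)‖ ^ 2 := by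
        simp only [Finset.prod_pow]
    _ ≤ ∏ b : Bool, ∏ c : Bool, ∏ d : Bool, ‖gowersForm Q s fun v =>
          F (Function.update (Function.update (Function.update v 2 d) 1 c) 0 b)‖ := by
        gcongr with b _ c
        exact norm_gowersForm_sq_le h s
          (fun v => F (Function.update (Function.update v 1 c) 0 b)) 2
    _ = ∏ v, ‖gowersForm Q s fun _ => F v‖ := by
        have hu : ∀ (b c d : Bool) (v : Vtx),
            Function.update (Function.update (Function.update v 2 d) 1 c) 0 b = ![b, c, d] := by
          intro b c d v; ext i; fin_cases i <;> rfl
        simp only [hu, prod_vtx, Fintype.prod_bool]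
        ring

theorem cConjFactor_add (v : Vtx) (a b : ℂ) :
    cConjFactor v (a + b) = cConjFactor v a + cConjFactor v b := by
  unfold cConjFactor; split_ifs <;> simp

theorem cConjFactor_mul (v : Vtx) (a b : ℂ) :
    cConjFactor v (a * b) = cConjFactor v a * cConjFactor v b := by
  unfold cConjFactor; split_ifs <;> simp

theorem cConjFactor_neg (v : Vtx) (a : ℂ) : cConjFactor v (-a) = -cConjFactor v a := by
  unfold cConjFactor; split_ifs <;> simp

theorem prod_cConjFactor_const (c : ℂ) : ∏ v, cConjFactor v c = ((‖c‖ ^ 8 : ℝ) : ℂ) := by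
  have : ∏ v, cConjFactor v c = (c * conj c) ^ 4 := by
    rw [prod_vtx]
    simp [cConjFactor]
    ring
  rw [this, Complex.mul_conj']
  push_cast
  ring

theorem gowersForm_const_add (Q : Set (Cube X)) (s : Finset X) (f g : X → ℂ) :
    gowersForm Q s (fun _ => f + g) =
      ∑ S : Vtx → Bool, gowersForm Q s fun v => if S v then f else g := by
  classical
  simp only [gowersForm]
  rw [Finset.sum_comm]
  refine Finset.sum_congr rfl fun x _ => ?_
  split_ifs with hx
  · have : ∀ v, cConjFactor v ((f + g) (x v)) =
        ∑ b : Bool, cConjFactor v ((if b then f else g) (x v)) := by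
      intro v
      simp [cConjFactor_add]
    simp only [this]
    rw [Finset.prod_univ_sum, Fintype.piFinset_univ]
  · simp

/-- The triangle inequality for the eighth root of the diagonal of the Gowers form. -/
theorem norm_gowersForm_add_rpow_le (h : IsWeakParallelepiped P Q) (s : Finset X)
    (f g : X → ℂ) :
    ‖gowersForm Q s fun _ => f + g‖ ^ ((1 : ℝ) / 8) ≤
      ‖gowersForm Q s fun _ => f‖ ^ ((1 : ℝ) / 8) +
        ‖gowersForm Q s fun _ => g‖ ^ ((1 : ℝ) / 8) := by
  set N : (X → ℂ) → ℝ := fun f => ‖gowersForm Q s fun _ => f‖ ^ ((1 : ℝ) / 8) with hN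
  have hN0 : ∀ f, 0 ≤ N f := fun f => by positivity
  have hN8 : ∀ f, N f ^ 8 = ‖gowersForm Q s fun _ => f‖ := by
    intro f
    rw [hN, ← Real.rpow_natCast, ← Real.rpow_mul (norm_nonneg _)]
    norm_num
  have hle : ∀ F : Vtx → X → ℂ, ‖gowersForm Q s F‖ ≤ ∏ v, N (F v) := by
    intro F
    refine le_of_pow_le_pow_left₀ (n := 8) (by norm_num)
      (Finset.prod_nonneg fun v _ => hN0 _) ?_
    rw [← Finset.prod_pow]
    simp only [hN8]
    exact norm_gowersForm_pow_le h s F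
  change N (f + g) ≤ N f + N g
  refine le_of_pow_le_pow_left₀ (n := 8) (by norm_num) (add_nonneg (hN0 _) (hN0 _)) ?_
  rw [hN8, gowersForm_const_add]
  refine (norm_sum_le _ _).trans ?_
  refine (Finset.sum_le_sum fun S _ => hle _).trans (le_of_eq ?_)
  have : (N f + N g) ^ 8 = ∏ v : Vtx, ∑ b : Bool, N (if b then f else g) := by simp
  rw [this, Finset.prod_univ_sum, Fintype.piFinset_univ]

theorem gSum3_nonneg (h : IsWeakParallelepiped P Q) (f : X →₀ ℂ) : 0 ≤ gSum3 Q f := by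
  rw [gSum3_eq_gowersForm Q subset_rfl]
  exact gowersForm_const_nonneg h _ _

theorem qNorm_eq_norm_rpow (h : IsWeakParallelepiped P Q) {s : Finset X} {f : X →₀ ℂ}
    (hf : f.support ⊆ s) :
    qNorm Q f = ‖gowersForm Q s fun _ => f‖ ^ ((1 : ℝ) / 8) := by
  rw [qNorm, ← gSum3_eq_gowersForm Q hf]
  congr 1
  exact_mod_cast Complex.eq_coe_norm_of_nonneg (gSum3_nonneg h f) ▸ Complex.ofReal_re _

theorem qNorm_smul (h : IsWeakParallelepiped P Q) (c : ℂ) (f : X →₀ ℂ) :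
    qNorm Q (c • f) = ‖c‖ * qNorm Q f := by
  have hs : gSum3 Q (c • f) = ((‖c‖ ^ 8 : ℝ) : ℂ) * gSum3 Q f := by
    rw [gSum3_eq_gowersForm Q Finsupp.support_smul,
      gSum3_eq_gowersForm Q subset_rfl, gowersForm, gowersForm, Finset.mul_sum]
    refine Finset.sum_congr rfl fun x _ => ?_
    split_ifs
    · simp [cConjFactor_mul, Finset.prod_mul_distrib, prod_cConjFactor_const]
    · simp
  have hre : 0 ≤ (gSum3 Q f).re := (Complex.nonneg_iff.1 (gSum3_nonneg h f)).1
  rw [qNorm, hs, Complex.re_ofReal_mul, Real.mul_rpow (by positivity) hre,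
    ← Real.rpow_natCast, ← Real.rpow_mul (norm_nonneg _)]
  norm_num [qNorm]

theorem qNorm_add_le (h : IsWeakParallelepiped P Q) (f g : X →₀ ℂ) :
    qNorm Q (f + g) ≤ qNorm Q f + qNorm Q g := by
  classical
  rw [qNorm_eq_norm_rpow h Finsupp.support_add,
    qNorm_eq_norm_rpow h (Finset.subset_union_left (s₁ := f.support) (s₂ := g.support)),
    qNorm_eq_norm_rpow h (Finset.subset_union_right (s₁ := f.support) (s₂ := g.support))]
  simpa using norm_gowersForm_add_rpow_le h (f.support ∪ g.support) f g

end GowersForm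

section Strong

variable {P : Set (Quad X)} {Q : Set (Cube X)}

theorem joinQuad_swap_first (h : IsWeakParallelepiped P Q) {a b c d a' b' c' d' : X}
    (hx : joinQuad (a, b, c, d) (a', b', c', d') ∈ Q) :
    joinQuad (a, b, a', b') (c, d, c', d') ∈ Q := by
  convert h.2.2.1 (Equiv.swap 0 1) (fun _ => false) _ hx using 1
  funext v
  revert v
  rw [forall_vtx]
  simp [joinQuad, quadAt, cubeSym, Equiv.swap_apply_def]

theorem joinQuad_swap_last (h : IsWeakParallelepiped P Q) {a b c d a' b' c' d' : X}
    (hx : joinQuad (a, b, c, d) (a', b', c', d') ∈ Q) :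
    joinQuad (a, c, b, d) (a', c', b', d') ∈ Q := by
  convert h.2.2.1 (Equiv.swap 1 2) (fun _ => false) _ hx using 1
  funext v
  revert v
  rw [forall_vtx]
  simp [joinQuad, quadAt, cubeSym, Equiv.swap_apply_def]

theorem joinQuad_const (h : IsWeakParallelepiped P Q) (a b : X) :
    joinQuad (a, a, a, a) (b, b, b, b) ∈ Q :=
  joinQuad_swap_first h (joinQuad_swap_last h (h.2.2.2.1 _ (h.1.1 a b)))

/-- Two completions `y, z` of the same seven points give a cube with seven vertices `y` and one
vertex `z`. -/
theorem joinQuad_of_two_completions (h : IsWeakParallelepiped P Q) {p : Quad X} {a b c y z : X}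
    (hy : joinQuad p (a, b, c, y) ∈ Q) (hz : joinQuad p (a, b, c, z) ∈ Q) :
    joinQuad (z, y, y, y) (y, y, y, y) ∈ Q := by
  have hyz := joinQuad_swap_first h (joinQuad_swap_last h
    (joinQuad_trans h _ _ _ (joinQuad_symm h _ _ hy) hz))
  have hyy := joinQuad_swap_first h (joinQuad_swap_last h
    (joinQuad_trans h _ _ _ (joinQuad_symm h _ _ hy) hy))
  have hb := joinQuad_swap_first h (joinQuad_swap_last h
    (joinQuad_trans h _ _ _ (joinQuad_symm h _ _ hyz) hyy))
  have hcube := joinQuad_trans h _ _ _ (joinQuad_symm h _ _ hb) (joinQuad_const h b y)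
  exact joinQuad_symm h _ _ (joinQuad_swap_first h (joinQuad_swap_last h hcube))

/-- If there is a cube with seven vertices `y` and one vertex `z`, then `y` may be replaced by
`z` at a vertex of any cube. -/
theorem joinQuad_replace (h : IsWeakParallelepiped P Q) {y z a b c : X} {q : Quad X}
    (hyz : joinQuad (z, y, y, y) (y, y, y, y) ∈ Q) (hx : joinQuad (y, a, b, c) q ∈ Q) :
    joinQuad (z, a, b, c) q ∈ Q := by
  have hP : (y, a, b, c) ∈ P := by
    simpa [face, insert3, joinQuad, quadAt] using h.2.1 _ hx 0 false
  have h1 := joinQuad_swap_first h (joinQuad_trans h _ _ _ hyz (joinQuad_const h y a))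
  have h2 : joinQuad (y, y, a, a) (b, b, c, c) ∈ Q :=
    joinQuad_swap_last h (joinQuad_swap_first h (h.2.2.2.1 _ hP))
  have h3 := joinQuad_trans h _ _ _ h1 h2
  have h4 : joinQuad (z, a, b, c) (y, a, b, c) ∈ Q :=
    joinQuad_swap_last h (joinQuad_swap_first h (joinQuad_swap_last h (joinQuad_swap_first h h3)))
  exact joinQuad_trans h _ _ _ h4 hx

theorem update_mem_of_joinQuad (h : IsWeakParallelepiped P Q) {y z : X}
    (hyz : joinQuad (z, y, y, y) (y, y, y, y) ∈ Q) {x : Cube X} (hx : x ∈ Q)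
    (hxy : x ![false, false, false] = y) :
    Function.update x ![false, false, false] z ∈ Q := by
  rw [← joinQuad_face x] at hx
  convert joinQuad_replace h (q := face x 0 true) (a := x ![false, false, true])
    (b := x ![false, true, false]) (c := x ![false, true, true]) hyz
    (by simpa [face, insert3, hxy] using hx) using 1
  funext v
  revert v
  rw [forall_vtx]
  simp [joinQuad, quadAt, face, insert3]

theorem gSum3_single_sub_single (h : IsWeakParallelepiped P Q) {y z : X}
    (hyz : joinQuad (z, y, y, y) (y, y, y, y) ∈ Q)
    (hzy : joinQuad (y, z, z, z) (z, z, z, z) ∈ Q) :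
    gSum3 Q (Finsupp.single y 1 - Finsupp.single z 1) = 0 := by
  classical
  set f : X →₀ ℂ := Finsupp.single y 1 - Finsupp.single z 1 with hf
  have hswap : ∀ x, f (Equiv.swap y z x) = -f x := by
    intro x
    have h1 : Equiv.swap y z x = y ↔ x = z := by rw [Equiv.swap_apply_eq_iff, Equiv.swap_apply_left]
    have h2 : Equiv.swap y z x = z ↔ x = y := by rw [Equiv.swap_apply_eq_iff, Equiv.swap_apply_right]
    simp only [hf, Finsupp.sub_apply, Finsupp.single_apply, eq_comm (a := y), eq_comm (a := z),
      h1, h2, neg_sub]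
  let v₀ : Vtx := ![false, false, false]
  let φ : Cube X → Cube X := fun x => Function.update x v₀ (Equiv.swap y z (x v₀))
  have hφ : Function.Involutive φ := fun x => by simp [φ]
  have hφQ : ∀ x ∈ Q, φ x ∈ Q := by
    intro x hx
    by_cases hxy : x v₀ = y
    · have := update_mem_of_joinQuad h hyz hx hxy
      simpa [φ, hxy] using this
    by_cases hxz : x v₀ = z
    · have := update_mem_of_joinQuad h hzy hx hxz
      simpa [φ, hxz] using this
    · simpa [φ, Equiv.swap_apply_of_ne_of_ne hxy hxz] using hx
  have hmem : ∀ x, φ x ∈ Q ↔ x ∈ Q := fun x => ⟨fun hx => hφ x ▸ hφQ _ hx, hφQ x⟩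
  have hprod : ∀ x : Cube X,
      ∏ v, cConjFactor v (f (φ x v)) = -∏ v, cConjFactor v (f (x v)) := by
    intro x
    rw [← Finset.mul_prod_erase _ _ (Finset.mem_univ v₀),
      ← Finset.mul_prod_erase (a := v₀) _ (fun v => cConjFactor v (f (x v))) (Finset.mem_univ v₀),
      ← neg_mul]
    refine congrArg₂ (· * ·) ?_ ?_
    · simp [φ, hswap, cConjFactor_neg]
    · refine Finset.prod_congr rfl fun v hv => ?_
      simp [φ, Finset.ne_of_mem_erase hv]
  rw [← self_eq_neg]
  simp only [gSum3, finsum_mem_def]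
  rw [← finsum_neg_distrib, ← finsum_comp_equiv hφ.toPerm]
  refine finsum_congr fun x => ?_
  simp only [Function.Involutive.coe_toPerm, Set.indicator_apply, hmem, hprod]
  split_ifs <;> simp

theorem isStrongParallelepiped_of_qNorm (h : IsWeakParallelepiped P Q)
    (hn : ∀ f : X →₀ ℂ, qNorm Q f = 0 → f = 0) : IsStrongParallelepiped P Q := by
  refine ⟨h, fun x000 x001 x010 x011 x100 x101 x110 h1 h2 h3 => ?_⟩
  obtain ⟨y, hy⟩ := h.2.2.2.2.2.2 _ _ _ _ _ _ _ h1 h2 h3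
  refine ⟨y, hy, fun z hz => ?_⟩
  have h0 := hn (Finsupp.single y 1 - Finsupp.single z 1) (by
    rw [qNorm, gSum3_single_sub_single h (joinQuad_of_two_completions h hy hz)
      (joinQuad_of_two_completions h hz hy)]
    norm_num)
  rw [sub_eq_zero] at h0
  exact (Finsupp.single_left_injective one_ne_zero h0).symm

theorem eq_zero_of_qNorm_eq_zero (h : IsStrongParallelepiped P Q) {f : X →₀ ℂ}
    (hf : qNorm Q f = 0) : f = 0 := by
  classical
  ext x₀
  set s := insert x₀ f.support with hs
  rw [qNorm_eq_norm_rpow h.1 (Finset.subset_insert x₀ _),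
    Real.rpow_eq_zero (norm_nonneg _) (by norm_num)] at hf
  set F : Vtx → X → ℂ := fun v => if v = fun _ => true then f else Pi.single x₀ 1 with hF
  have hF0 : gowersForm Q s F = 0 := by
    have := norm_gowersForm_pow_le h.1 s F
    rw [Finset.prod_eq_zero (Finset.mem_univ (fun _ => true))] at this
    · exact norm_eq_zero.1 (pow_eq_zero_iff (by norm_num) |>.1 (le_antisymm this (by positivity)))
    · simpa [hF] using hf
  have hP : (x₀, x₀, x₀, x₀) ∈ P := h.1.1.1 x₀ x₀
  have hmem : (fun _ => x₀) ∈ Q := by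
    convert h.1.2.2.2.1 _ hP using 1
    funext v
    revert v
    rw [forall_vtx]
    simp [joinQuad, quadAt]
  rw [gowersForm, Finset.sum_eq_single fun _ => x₀, if_pos hmem, Finset.prod_eq_zero_iff] at hF0
  · obtain ⟨v, -, hv⟩ := hF0
    rw [cConjFactor_eq_zero] at hv
    by_cases hv1 : v = fun _ => true
    · simpa [hF, hv1] using hv
    · simp [hF, hv1] at hv
  · intro x _ hx
    split_ifs with hxQ
    · by_contra hprod
      have hne : ∀ v, v ≠ (fun _ => true) → x v = x₀ := by
        intro v hv
        by_contra hxv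
        refine hprod (Finset.prod_eq_zero (Finset.mem_univ v) ?_)
        simp [hF, hv, hxv]
      have hxj : ∀ x : Cube X, (∀ v, v ≠ (fun _ => true) → x v = x₀) →
          x = joinQuad (x₀, x₀, x₀, x₀) (x₀, x₀, x₀, x fun _ => true) := by
        intro x hx
        have ht : (![true, true, true] : Vtx) = fun _ => true := by decide
        funext v
        revert v
        rw [forall_vtx]
        refine ⟨hx _ ?_, hx _ ?_, hx _ ?_, hx _ ?_, hx _ ?_, hx _ ?_, hx _ ?_, by rw [ht]; rfl⟩ <;>
          decide
      have hu := (h.2 x₀ x₀ x₀ x₀ x₀ x₀ x₀ hP hP hP).unique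
        (y₁ := x fun _ => true) (y₂ := x₀) (by rwa [← hxj x hne])
        (h.1.2.2.2.1 _ hP)
      apply hx
      funext v
      by_cases hv : v = fun _ => true
      · rw [hv, hu]
      · exact hne v hv
    · rfl
  · intro hx
    simp [Fintype.mem_piFinset, hs] at hx

end Strong

open scoped ComplexOrder in
/-- For a weak parallelepiped structure `(P, Q)` on a nonempty set `X`, the
Gowers sum over `Q` of any finitely supported `f : X → ℂ` is a nonnegative real, `‖·‖_Q` is a
seminorm on finitely supported functions, and it is a norm iff `(P, Q)` is strong. -/
theorem gowers_three_seminorm (X : Type) [Nonempty X]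
    (P : Set (Quad X)) (Q : Set (Cube X)) (h : IsWeakParallelepiped P Q) :
    (∀ f : X →₀ ℂ, 0 ≤ gSum3 Q f) ∧
    (∀ f : X →₀ ℂ, 0 ≤ qNorm Q f) ∧
    (∀ (c : ℂ) (f : X →₀ ℂ), qNorm Q (c • f) = ‖c‖ * qNorm Q f) ∧
    (∀ f g : X →₀ ℂ, qNorm Q (f + g) ≤ qNorm Q f + qNorm Q g) ∧
    ((∀ f : X →₀ ℂ, qNorm Q f = 0 → f = 0) ↔ IsStrongParallelepiped P Q) := by
  exact ⟨gSum3_nonneg h, fun f => Real.rpow_nonneg (Complex.nonneg_iff.1 (gSum3_nonneg h f)).1 _,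
    qNorm_smul h, qNorm_add_le h, isStrongParallelepiped_of_qNorm h,
    fun hs _ hf => eq_zero_of_qNorm_eq_zero hs hf⟩

end HK
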